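/- arXiv:1205.2905 — 2 statements merged into one kernel-verified Lean document; each statement's English description precedes it below -/
import Mathlib

section
/- The topological entropy of the squarefree flow (X, σ) equals log 2 · ∏_p (1 − 1/p²) = (6/π²) log 2, where the product runs over all primes p. -/
open MeasureTheory Filter Set
open scoped ENNReal Classical

noncomputable section

/-- The sequence space `{0,1}^{ℕ*}`; index `n : ℕ` represents the positive integer `n + 1`. -/
abbrev Omega2 : Type := ℕ → Bool

/-- The left shift `(σ x)_n = x_{n+1}`. -/
def shift : Omega2 → Omega2 := fun x n => x (n + 1)

/-- `x` omits the residue class `a` modulo `q` (the position of index `n` is `n + 1`). -/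
def OmitsMod (x : Omega2) (q : ℕ) (a : ZMod q) : Prop :=
  ∀ n : ℕ, ((n + 1 : ℕ) : ZMod q) = a → x n = false

/-- The squarefree flow: sequences whose support omits at least one residue class
modulo `p ^ 2` for every prime `p`. -/
def SqfFlow : Set Omega2 :=
  {x | ∀ p : Nat.Primes, ∃ a : ZMod ((p : ℕ) ^ 2), OmitsMod x ((p : ℕ) ^ 2) a}

instance (p : Nat.Primes) : NeZero ((p : ℕ) ^ 2) := ⟨pow_ne_zero 2 p.2.ne_zero⟩
instance (n : ℕ) : MeasurableSpace (ZMod n) := ⊤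
instance (n : ℕ) : TopologicalSpace (ZMod n) := ⊥
instance (n : ℕ) : DiscreteTopology (ZMod n) := ⟨rfl⟩

/-- The group `G = ∏_p ℤ/p²ℤ`. -/
abbrev G : Type := ∀ p : Nat.Primes, ZMod ((p : ℕ) ^ 2)

/-- Translation by `(-1, -1, -1, …)` on `G`. -/
def T1 : G → G := fun g p => g p - 1

/-- `G₁ = {g : g_p ≡ 1 mod p² for some prime p}`. -/
def G1 : Set G := {g | ∃ p : Nat.Primes, g p = 1}

/-- Shannon entropy of the finite partition of `α` induced by `f`. -/
def partH {α β : Type*} [MeasurableSpace α] [Fintype β] (μ : Measure α) (f : α → β) : ℝ :=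
  ∑ b : β, Real.negMulLog ((μ (f ⁻¹' {b})).toReal)

/-- Entropy of the process generated by the observable `f` under `T`. -/
def procH {α : Type*} [MeasurableSpace α] (μ : Measure α) (T : α → α)
    {k : ℕ} (f : α → Fin k) : ℝ :=
  ⨅ n : ℕ, partH μ (fun x (i : Fin (n + 1)) => f (T^[(i : ℕ)] x)) / (n + 1)

/-- Kolmogorov–Sinai entropy of `T` with respect to `μ`: supremum over finite measurable
partitions (encoded as finite-valued measurable observables). -/
def ksEntropy {α : Type*} [MeasurableSpace α] (μ : Measure α) (T : α → α) : EReal :=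
  ⨆ (k : ℕ) (f : α → Fin k) (_ : Measurable f), ((procH μ T f : ℝ) : EReal)

/-- First return time (`0` if the point never returns). -/
def retTime {α : Type*} (T : α → α) (Y : Set α) (x : α) : ℕ :=
  sInf {n : ℕ | 0 < n ∧ T^[n] x ∈ Y}

/-- Induced (first–return) transformation, as a map of the ambient space. -/
def inducedAmb {α : Type*} (T : α → α) (Y : Set α) (x : α) : α :=
  T^[retTime T Y x] x

/-- Number of omitted residue classes modulo `q`. -/
def numOmitted (x : Omega2) (q : ℕ) : ℕ := Set.ncard {a : ZMod q | OmitsMod x q a}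

/-- `x` is persistent modulo `q`: every residue class meeting the support meets it infinitely. -/
def Persistent (x : Omega2) (q : ℕ) : Prop :=
  ∀ a : ZMod q, (∃ n : ℕ, ((n + 1 : ℕ) : ZMod q) = a ∧ x n = true) →
    {n : ℕ | ((n + 1 : ℕ) : ZMod q) = a ∧ x n = true}.Infinite

/-- The set of `p`-persistent sequences in the squarefree flow. -/
def SP (p : Nat.Primes) : Set Omega2 := {x ∈ SqfFlow | Persistent x ((p : ℕ) ^ 2)}

/-- `X_I`: sequences omitting exactly `I p` classes mod `p²` and persistent for every `p`. -/
def XI (I : Nat.Primes → ℕ) : Set Omega2 :=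
  {x ∈ SqfFlow | (∀ p : Nat.Primes, numOmitted x ((p : ℕ) ^ 2) = I p) ∧
    ∀ p : Nat.Primes, Persistent x ((p : ℕ) ^ 2)}

/-- `X₁ = X_{(1,1,1,…)}`. -/
def X1 : Set Omega2 := XI fun _ => 1

/-- `ρ(x)_p` is the (unique, for `x ∈ X₁`) omitted residue class mod `p²`. -/
def rho (x : Omega2) : G := fun p =>
  if h : ∃ a : ZMod ((p : ℕ) ^ 2), OmitsMod x ((p : ℕ) ^ 2) a then h.choose else 0

/-- `Y = ρ⁻¹(G₁ᶜ) ⊆ X₁`. -/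
def Y : Set Omega2 := {x ∈ X1 | rho x ∈ G1ᶜ}

/-- `α_g(m) = #{1 ≤ n ≤ m : n ≡ g_p mod p² for some prime p}`. -/
def alphaG (g : G) (m : ℕ) : ℕ :=
  Set.ncard {n : ℕ | 1 ≤ n ∧ n ≤ m ∧ ∃ p : Nat.Primes, ((n : ℕ) : ZMod ((p : ℕ) ^ 2)) = g p}

/-- The insertion map `ι : G × Ω⁽²⁾ → X`; position of index `n` is `m = n + 1`, and the
`1`-based value `y_{m - α_g(m)}` is the `0`-based entry `y (n - α_g(n+1))`. -/
def iota (g : G) (y : Omega2) : Omega2 := fun n =>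
  if ∃ p : Nat.Primes, ((n + 1 : ℕ) : ZMod ((p : ℕ) ^ 2)) = g p then false
  else y (n - alphaG g (n + 1))

/-- The skew product `T(g,y) = (T₁ g, σ^{ψ(g)} y)`, `ψ = 1 - 1_{G₁}`. -/
def skewT : G × Omega2 → G × Omega2 := fun gy =>
  if gy.1 ∈ G1 then (T1 gy.1, gy.2) else (T1 gy.1, shift gy.2)

/-- `G₁ᶜ × Ω⁽²⁾` as a subset of `G × Ω⁽²⁾`. -/
def ZSet : Set (G × Omega2) := G1ᶜ ×ˢ (Set.univ : Set Omega2)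

/-- `x̂`: delete from `x` the entries at positions congruent to `(g_x)_p` mod `p²` for some `p`. -/
def hat (x : Omega2) : Omega2 := fun m =>
  x (Nat.nth (fun j => ¬ ∃ p : Nat.Primes, ((j + 1 : ℕ) : ZMod ((p : ℕ) ^ 2)) = rho x p) m)

/-- A Haar probability measure on `G`: a translation-invariant Borel probability measure. -/
def IsHaarLike (m : Measure G) : Prop :=
  IsProbabilityMeasure m ∧ ∀ g : G, MeasurePreserving (fun h => g + h) m m

/-- The `(1/2, 1/2)` Bernoulli measure on `Ω⁽²⁾`, characterized by its cylinder values. -/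
def IsBernoulliHalf (ω : Measure Omega2) : Prop :=
  IsProbabilityMeasure ω ∧
    ∀ (s : Finset ℕ) (v : ℕ → Bool), ω {x | ∀ i ∈ s, x i = v i} = (1 / 2 : ℝ≥0∞) ^ s.card

/-- Normalized restriction of a measure on `G` to `G₁ᶜ`. -/
def mbar (m : Measure G) : Measure G := (m G1ᶜ)⁻¹ • m.restrict G1ᶜ

/-- The `k`-th prime (`0`-indexed), as an element of `Nat.Primes`. -/
def nthPrime (k : ℕ) : Nat.Primes := ⟨Nat.nth Nat.Prime k, Nat.prime_nth_prime k⟩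

/-- `X(r)`: sequences omitting at least one class mod `p_i²` for the first `r` primes. -/
def Xr (r : ℕ) : Set Omega2 :=
  {x | ∀ k : Fin r, ∃ a : ZMod ((nthPrime k : ℕ) ^ 2), OmitsMod x ((nthPrime k : ℕ) ^ 2) a}

/-- `X_I(r)`: elements of `X(r)` omitting exactly `I k` classes mod `p_k²` for `k ≤ r`. -/
def XIr (r : ℕ) (I : Fin r → ℕ) : Set Omega2 :=
  {x ∈ Xr r | ∀ k : Fin r, numOmitted x ((nthPrime k : ℕ) ^ 2) = I k}

/-- Number of distinct words of length `L` occurring in elements of `F`. -/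
def wordCount (F : Set Omega2) (L : ℕ) : ℕ :=
  Set.ncard {w : Fin L → Bool | ∃ x ∈ F, ∃ j : ℕ, ∀ t : Fin L, w t = x (j + (t : ℕ))}

/-- `α_g^r(m)`, counting only the first `r` primes. -/
def alphaGr (r : ℕ) (g : G) (m : ℕ) : ℕ :=
  Set.ncard {n : ℕ | 1 ≤ n ∧ n ≤ m ∧
    ∃ k : Fin r, ((n : ℕ) : ZMod ((nthPrime k : ℕ) ^ 2)) = g (nthPrime k)}

/-- The partial insertion map `ι_r`. -/
def iotaR (r : ℕ) (g : G) (y : Omega2) : Omega2 := fun n =>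
  if ∃ k : Fin r, ((n + 1 : ℕ) : ZMod ((nthPrime k : ℕ) ^ 2)) = g (nthPrime k) then false
  else y (n - alphaGr r g (n + 1))


open Dynamics Topology Uniformity

lemma count_mul_of_periodic {P : ℕ → Prop} [DecidablePred P] {M : ℕ}
    (hP : Function.Periodic P M) (k : ℕ) : Nat.count P (k * M) = k * Nat.count P M := by
  induction k with
  | zero => simp
  | succ k ih =>
    have h : (fun n => P (k * M + n)) = P := by
      funext n
      rw [add_comm]
      exact hP.nat_mul k n
    rw [add_mul, one_mul, Nat.count_add, ih, add_mul, one_mul]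
    congr 1
    simp only [h]

section CRT

open Function

variable {ι : Type*} [Fintype ι] (q : ι → ℕ) [∀ i, NeZero (q i)]

/-- By the Chinese remainder theorem, the number of `1 ≤ n ≤ ∏ i, q i` avoiding one residue
class modulo each of the pairwise coprime `q i` is `∏ i, (q i - 1)`. -/
lemma count_forall_ne_prod (hq : Pairwise (Nat.Coprime on q)) (a : ∀ i, ZMod (q i)) :
    Nat.count (fun n => ∀ i, ((n + 1 : ℕ) : ZMod (q i)) ≠ a i) (∏ i, q i)
      = ∏ i, (q i - 1) := by
  have : NeZero (∏ i, q i) := ⟨Finset.prod_ne_zero_iff.2 fun i _ => NeZero.ne _⟩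
  have hcard : (Fintype.piFinset fun i => (Finset.univ : Finset (ZMod (q i))).erase (a i)).card
      = ∏ i, (q i - 1) := by
    rw [Fintype.card_piFinset]
    refine Finset.prod_congr rfl fun i _ => ?_
    rw [Finset.card_erase_of_mem (Finset.mem_univ _), Finset.card_univ, ZMod.card]
  rw [Nat.count_eq_card_filter_range, ← hcard]
  have hcast (n : ℕ) (i : ι) : ZMod.prodEquivPi q hq (n : ZMod (∏ i, q i)) i = n := by
    rw [map_natCast]; rfl
  refine Finset.card_bij (fun n _ i => ((n + 1 : ℕ) : ZMod (q i))) ?_ ?_ ?_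
  · intro n hn
    simpa using (Finset.mem_filter.1 hn).2
  · intro m hm n hn h
    have h1 : ((m + 1 : ℕ) : ZMod (∏ i, q i)) = ((n + 1 : ℕ) : ZMod (∏ i, q i)) := by
      apply (ZMod.prodEquivPi q hq).injective
      funext i
      rw [hcast, hcast]
      exact congrFun h i
    rw [ZMod.natCast_eq_natCast_iff] at h1
    have h2 : m ≡ n [MOD ∏ i, q i] := Nat.ModEq.add_right_cancel' 1 h1
    have hm := Finset.mem_range.1 (Finset.mem_filter.1 hm).1
    have hn := Finset.mem_range.1 (Finset.mem_filter.1 hn).1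
    rwa [Nat.ModEq, Nat.mod_eq_of_lt hm, Nat.mod_eq_of_lt hn] at h2
  · intro z hz
    let w : ZMod (∏ i, q i) := (ZMod.prodEquivPi q hq).symm z - 1
    have hw : ∀ i, ((w.val + 1 : ℕ) : ZMod (q i)) = z i := by
      intro i
      rw [← hcast, Nat.cast_add, ZMod.natCast_zmod_val, Nat.cast_one, sub_add_cancel,
        RingEquiv.apply_symm_apply]
    refine ⟨w.val, ?_, funext hw⟩
    refine Finset.mem_filter.2 ⟨Finset.mem_range.2 (ZMod.val_lt w), fun i => ?_⟩
    rw [hw]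
    simpa using Fintype.mem_piFinset.1 hz i

lemma count_forall_ne (hq : Pairwise (Nat.Coprime on q)) (a : ∀ i, ZMod (q i)) (k : ℕ) :
    Nat.count (fun n => ∀ i, ((n + 1 : ℕ) : ZMod (q i)) ≠ a i) (k * ∏ i, q i)
      = k * ∏ i, (q i - 1) := by
  rw [count_mul_of_periodic, count_forall_ne_prod q hq a]
  intro n
  have (i : ι) : ((∏ i, q i : ℕ) : ZMod (q i)) = 0 :=
    (ZMod.natCast_eq_zero_iff _ _).2 (Finset.dvd_prod_of_mem q (Finset.mem_univ i))
  have h (i : ι) : ((n + ∏ i, q i + 1 : ℕ) : ZMod (q i)) = ((n + 1 : ℕ) : ZMod (q i)) := by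
    rw [add_right_comm, Nat.cast_add, this, add_zero]
  simp only [h]

end CRT

section Shift

lemma shift_iterate_apply (k : ℕ) (x : Omega2) (n : ℕ) : shift^[k] x n = x (n + k) := by
  induction k generalizing x with
  | zero => rfl
  | succ k ih => rw [Function.iterate_succ_apply, ih]; simp [shift, add_assoc]

/-- The relation of agreeing on the first `L` coordinates. -/
def agree (L : ℕ) : SetRel Omega2 Omega2 := {z | ∀ i < L, z.1 i = z.2 i}

instance (L : ℕ) : (agree L).IsSymm := ⟨fun _ _ h i hi => (h i hi).symm⟩

lemma agree_comp_agree (L : ℕ) : SetRel.comp (agree L) (agree L) ⊆ agree L := by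
  rintro ⟨x, y⟩ ⟨z, h1, h2⟩ i hi
  exact (h1 i hi).trans (h2 i hi)

lemma agree_one_mem_uniformity : agree 1 ∈ 𝓤 Omega2 := by
  have h : (SetRel.id : SetRel Bool Bool) ∈ 𝓤 Bool := DiscreteUniformity.relId_mem_uniformity Bool
  filter_upwards [Pi.uniformContinuous_proj (fun _ : ℕ => Bool) 0 h] with z hz i hi
  obtain rfl : i = 0 := by omega
  exact hz

lemma exists_agree_subset {U : SetRel Omega2 Omega2} (hU : U ∈ 𝓤 Omega2) :
    ∃ L, agree L ⊆ U := by
  have hB : 𝓤 Bool = 𝓟 SetRel.id := DiscreteUniformity.eq_principal_setRelId Bool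
  simp only [Pi.uniformity, hB, comap_principal] at hU
  obtain ⟨t, ht, hsub⟩ := (hasBasis_iInf_principal_finite _).mem_iff.1 hU
  obtain ⟨L, hL⟩ := ht.bddAbove
  refine ⟨L + 1, fun z hz => hsub ?_⟩
  simp only [Set.mem_iInter]
  exact fun i hi => hz i (Nat.lt_succ_of_le (hL hi))

/-- Upper bound on the entropy of a shift-invariant set from the number of its prefixes along a
sequence of lengths. -/
lemma coverEntropy_shift_le {F : Set Omega2} (hF : MapsTo shift F F) {c C : ℝ} (hC : 0 < C)
    {N : ℕ → ℕ} (hN : Tendsto N atTop atTop)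
    (h : ∀ k, ∃ s : Finset Omega2, (s.card : ℝ) ≤ C * Real.exp (c * N k) ∧
      ∀ x ∈ F, ∃ y ∈ s, ∀ i < N k, x i = y i) :
    coverEntropy shift F ≤ (c : EReal) := by
  refine iSup₂_le fun U hU => ?_
  obtain ⟨L, hL⟩ := exists_agree_subset hU
  have hlim : Tendsto (fun m : ℕ => (Real.log C + c * m) / (m - L)) atTop (𝓝 c) := by
    have h1 : Tendsto (fun m : ℕ => (m : ℝ) - L) atTop atTop :=
      tendsto_atTop_add_const_right _ (-(L : ℝ)) tendsto_natCast_atTop_atTop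
    have h2 := (tendsto_const_nhds (x := Real.log C + c * L)).div_atTop h1
    have h3 := h2.const_add c
    rw [add_zero] at h3
    refine h3.congr' ?_
    filter_upwards [h1.eventually_gt_atTop 0] with m hm
    field_simp
    ring
  refine ge_of_tendsto ((continuous_coe_real_ereal.tendsto c).comp (hlim.comp hN)) ?_
  filter_upwards [hN.eventually_gt_atTop L] with k hk
  obtain ⟨s, hs, hcov⟩ := h k
  have hdyn : IsDynCoverOf shift F (agree L) (N k - L) (s : Set Omega2) := by
    intro x hx
    obtain ⟨y, hy, hxy⟩ := hcov x hx
    refine ⟨y, hy, mem_dynEntourage.2 fun j hj i hi => ?_⟩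
    simp only [shift_iterate_apply]
    exact hxy _ (by omega)
  have hn : N k - L ≠ 0 := by omega
  have hpos : (0 : ℝ) < ((N k - L : ℕ) : ℝ) := by exact_mod_cast Nat.pos_of_ne_zero hn
  calc coverEntropyEntourage shift F U
      ≤ coverEntropyEntourage shift F (SetRel.comp (agree L) (agree L)) :=
        coverEntropyEntourage_antitone _ _ ((agree_comp_agree L).trans hL)
    _ ≤ ENNReal.log s.card / (N k - L : ℕ) :=
        hdyn.coverEntropyEntourage_le_log_card_div hF hn
    _ ≤ ((Real.log C + c * N k : ℝ) : EReal) / (N k - L : ℕ) := by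
        refine EReal.monotone_div_right_of_nonneg (Nat.cast_nonneg' _) ?_
        have hexp : Real.log (C * Real.exp (c * N k)) = Real.log C + c * N k := by
          rw [Real.log_mul hC.ne' (Real.exp_ne_zero _), Real.log_exp]
        rw [← hexp, ← ENNReal.log_ofReal_of_pos (by positivity)]
        refine ENNReal.log_monotone ?_
        rw [← ENNReal.ofReal_natCast]
        exact ENNReal.ofReal_le_ofReal hs
    _ = _ := by
        simp only [Function.comp_apply]
        rw [← Nat.cast_sub hk.le, EReal.coe_div]
        norm_cast

/-- Lower bound on the entropy of the shift from the number of prefixes of given lengths. -/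
lemma le_coverEntropy_shift {F : Set Omega2} {c : ℝ}
    (h : ∃ᶠ n : ℕ in atTop, ∃ s : Finset Omega2, (s : Set Omega2) ⊆ F ∧
      (∀ x ∈ s, ∀ y ∈ s, (∀ i < n, x i = y i) → x = y) ∧ Real.exp (c * n) ≤ s.card) :
    (c : EReal) ≤ coverEntropy shift F := by
  refine le_trans ?_ (netEntropyEntourage_le_coverEntropy _ _ agree_one_mem_uniformity)
  refine Frequently.le_expGrowthSup (h.mono ?_)
  rintro n ⟨s, hsF, hs, hcard⟩
  have hnet : IsDynNetIn shift F (agree 1) n (s : Set Omega2) := by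
    refine ⟨hsF, fun x hx y hy hxy => Set.disjoint_left.2 fun z hzx hzy => hxy ?_⟩
    refine hs x hx y hy fun i hi => ?_
    have h1 := mem_dynEntourage.1 hzx i hi 0 one_pos
    have h2 := mem_dynEntourage.1 hzy i hi 0 one_pos
    simp only [shift_iterate_apply, zero_add] at h1 h2
    exact h1.trans h2.symm
  calc EReal.exp (c * n) = ENNReal.ofReal (Real.exp (c * n)) := by
        rw [← EReal.exp_coe]; norm_cast
    _ ≤ (s.card : ℝ≥0∞) := by
        rw [← ENNReal.ofReal_natCast]; exact ENNReal.ofReal_le_ofReal hcard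
    _ ≤ _ := by
        have := ENat.toENNReal_le.2 hnet.card_le_netMaxcard
        simpa using this

end Shift

section Primes

/-- The Euler product `∏_p (1 - p⁻²) = 6 / π²`. -/
lemma hasProd_one_sub_inv_sq :
    HasProd (fun p : Nat.Primes => (1 - 1 / ((p : ℕ) : ℝ) ^ 2)) (6 / Real.pi ^ 2) := by
  let f : ℕ →*₀ ℝ :=
    { toFun := fun n => 1 / (n : ℝ) ^ 2
      map_zero' := by simp
      map_one' := by simp
      map_mul' := fun m n => by push_cast; rw [mul_pow, one_div_mul_one_div] }
  have hf : HasSum f (Real.pi ^ 2 / 6) := hasSum_zeta_two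
  have h := EulerProduct.eulerProduct_completely_multiplicative_hasProd (f := f) hf.summable.norm
  rw [hf.tsum_eq] at h
  have h2 := h.inv₀ (by positivity)
  simp only [inv_inv, inv_div] at h2
  exact h2

lemma pairwise_coprime_sq (S : Finset Nat.Primes) :
    Pairwise (Function.onFun Nat.Coprime fun p : S => ((p : Nat.Primes) : ℕ) ^ 2) := by
  intro p r hpr
  refine Nat.Coprime.pow _ _ ((Nat.coprime_primes p.1.2 r.1.2).2 fun h => hpr ?_)
  exact Subtype.ext (Subtype.ext h)

lemma cast_prod_sq_sub_one (S : Finset Nat.Primes) :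
    ((∏ p : S, (((p : Nat.Primes) : ℕ) ^ 2 - 1) : ℕ) : ℝ) =
      ((∏ p : S, ((p : Nat.Primes) : ℕ) ^ 2 : ℕ) : ℝ) *
        ∏ p ∈ S, (1 - 1 / ((p : ℕ) : ℝ) ^ 2) := by
  rw [← Finset.prod_coe_sort S fun p : Nat.Primes => (1 - 1 / ((p : ℕ) : ℝ) ^ 2)]
  push_cast
  rw [← Finset.prod_mul_distrib]
  refine Finset.prod_congr rfl fun p _ => ?_
  have hp : (((p : Nat.Primes) : ℕ) : ℝ) ≠ 0 := by exact_mod_cast p.1.2.ne_zero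
  rw [Nat.cast_sub (Nat.one_le_pow _ _ p.1.2.pos)]
  push_cast
  field_simp

lemma prod_sq_pos (S : Finset Nat.Primes) : 0 < ∏ p : S, ((p : Nat.Primes) : ℕ) ^ 2 :=
  Finset.prod_pos fun p _ => pow_pos p.1.2.pos 2

lemma mapsTo_shift_sqfFlow : MapsTo shift SqfFlow SqfFlow := by
  intro x hx p
  obtain ⟨a, ha⟩ := hx p
  refine ⟨a - 1, fun n hn => ha (n + 1) ?_⟩
  rw [Nat.cast_succ, hn, sub_add_cancel]

lemma card_image_powerset_le (s : Finset ℕ) :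
    (s.powerset.image fun (t : Finset ℕ) (n : ℕ) => decide (n ∈ t)).card ≤ 2 ^ s.card :=
  Finset.card_image_le.trans_eq (Finset.card_powerset s)

lemma two_pow_eq_exp (n : ℕ) : (2 : ℝ) ^ n = Real.exp (Real.log 2 * n) := by
  rw [mul_comm, Real.exp_nat_mul, Real.exp_log two_pos]

lemma coverEntropy_sqfFlow_le (S : Finset Nat.Primes) :
    coverEntropy shift SqfFlow ≤
      ((Real.log 2 * ∏ p ∈ S, (1 - 1 / ((p : ℕ) : ℝ) ^ 2) : ℝ) : EReal) := by
  set M := ∏ p : S, ((p : Nat.Primes) : ℕ) ^ 2 with hM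
  have hMpos : 0 < M := prod_sq_pos S
  refine coverEntropy_shift_le mapsTo_shift_sqfFlow (C := M) (by exact_mod_cast hMpos)
    (N := fun k => k * M) (tendsto_id.atTop_mul_const' hMpos) fun k => ?_
  let A : (∀ p : S, ZMod (((p : Nat.Primes) : ℕ) ^ 2)) → Finset ℕ := fun a =>
    (Finset.range (k * M)).filter fun n =>
      ∀ p : S, ((n + 1 : ℕ) : ZMod (((p : Nat.Primes) : ℕ) ^ 2)) ≠ a p
  have hA (a) : (A a).card = k * ∏ p : S, (((p : Nat.Primes) : ℕ) ^ 2 - 1) := by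
    rw [← count_forall_ne _ (pairwise_coprime_sq S) a k, Nat.count_eq_card_filter_range]
  refine ⟨Finset.univ.biUnion fun a => (A a).powerset.image fun t n => decide (n ∈ t), ?_, ?_⟩
  · have h1 : (Finset.univ.biUnion fun a => (A a).powerset.image
        fun (t : Finset ℕ) (n : ℕ) => decide (n ∈ t)).card
        ≤ M * 2 ^ (k * ∏ p : S, (((p : Nat.Primes) : ℕ) ^ 2 - 1)) := by
      refine (Finset.card_biUnion_le_card_mul _ _ _ fun a _ =>
        (card_image_powerset_le (A a)).trans_eq (by rw [hA])).trans_eq ?_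
      rw [Finset.card_univ, Fintype.card_pi]
      simp only [ZMod.card, hM]
    refine (Nat.cast_le.2 h1).trans_eq ?_
    rw [Nat.cast_mul, Nat.cast_pow, Nat.cast_two, two_pow_eq_exp, Nat.cast_mul,
      cast_prod_sq_sub_one, Nat.cast_mul]
    congr 2
    ring
  · intro x hx
    choose a ha using hx
    refine ⟨fun n => decide (n ∈ (Finset.range (k * M)).filter fun n => x n = true), ?_, ?_⟩
    · refine Finset.mem_biUnion.2 ⟨fun p => a p, Finset.mem_univ _, Finset.mem_image.2 ⟨_, ?_, rfl⟩⟩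
      refine Finset.mem_powerset.2 fun n hn => ?_
      obtain ⟨hn, hxn⟩ := Finset.mem_filter.1 hn
      refine Finset.mem_filter.2 ⟨hn, fun p hp => ?_⟩
      rw [ha p n hp] at hxn
      exact Bool.false_ne_true hxn
    · intro i hi
      simp [hi]

/-- The `1 ≤ n ≤ N` (shifted by one) not divisible by any prime square. -/
def sqfreeBelow (N : ℕ) : Finset ℕ :=
  (Finset.range N).filter fun n => ∀ p : Nat.Primes, ¬ (p : ℕ) ^ 2 ∣ n + 1

lemma summable_one_div_prime_sq :
    Summable fun p : Nat.Primes => 1 / ((p : ℕ) : ℝ) ^ 2 :=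
  (Real.summable_one_div_nat_pow.2 one_lt_two).comp_injective Subtype.val_injective

lemma le_card_sqfreeBelow (S : Finset Nat.Primes) (k : ℕ) :
    ((k * ∏ p : S, ((p : Nat.Primes) : ℕ) ^ 2 : ℕ) : ℝ) *
      (∏ p ∈ S, (1 - 1 / ((p : ℕ) : ℝ) ^ 2) -
        ∑' p : {p // p ∉ S}, 1 / (((p : Nat.Primes) : ℕ) : ℝ) ^ 2) ≤
      (sqfreeBelow (k * ∏ p : S, ((p : Nat.Primes) : ℕ) ^ 2)).card := by
  set M := ∏ p : S, ((p : Nat.Primes) : ℕ) ^ 2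
  set N := k * M
  let A : Finset ℕ := (Finset.range N).filter fun n =>
    ∀ p : S, ((n + 1 : ℕ) : ZMod (((p : Nat.Primes) : ℕ) ^ 2)) ≠ 0
  have hA : A.card = k * ∏ p : S, (((p : Nat.Primes) : ℕ) ^ 2 - 1) := by
    rw [← count_forall_ne _ (pairwise_coprime_sq S) (fun _ => 0) k, Nat.count_eq_card_filter_range]
  have hfin : Set.Finite {p : {p : Nat.Primes // p ∉ S} | ((p : Nat.Primes) : ℕ) ≤ N} :=
    (Set.finite_Iic N).preimage
      (Subtype.val_injective.comp Subtype.val_injective).injOn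
  let B (p : {p : Nat.Primes // p ∉ S}) : Finset ℕ :=
    (Finset.range N).filter fun n => ((p : Nat.Primes) : ℕ) ^ 2 ∣ n + 1
  have hsub : A ⊆ sqfreeBelow N ∪ hfin.toFinset.biUnion B := by
    intro n hn
    obtain ⟨hnN, hn⟩ := Finset.mem_filter.1 hn
    by_cases hp : ∀ p : Nat.Primes, ¬ (p : ℕ) ^ 2 ∣ n + 1
    · exact Finset.mem_union_left _ (Finset.mem_filter.2 ⟨hnN, hp⟩)
    · push Not at hp
      obtain ⟨p, hp⟩ := hp
      have hpS : p ∉ S := fun h => hn ⟨p, h⟩ ((ZMod.natCast_eq_zero_iff _ _).2 hp)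
      refine Finset.mem_union_right _ (Finset.mem_biUnion.2 ⟨⟨p, hpS⟩, ?_,
        Finset.mem_filter.2 ⟨hnN, hp⟩⟩)
      have h1 : (p : ℕ) ≤ n + 1 :=
        Nat.le_of_dvd n.succ_pos ((dvd_pow_self _ two_ne_zero).trans hp)
      have h2 := Finset.mem_range.1 hnN
      simp only [Set.Finite.mem_toFinset, Set.mem_ofPred_eq]
      omega
  have hcard : A.card ≤ (sqfreeBelow N).card + ∑ p ∈ hfin.toFinset, (B p).card :=
    (Finset.card_le_card hsub).trans ((Finset.card_union_le _ _).trans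
      (Nat.add_le_add_left Finset.card_biUnion_le _))
  have hB : (∑ p ∈ hfin.toFinset, ((B p).card : ℝ)) ≤
      N * ∑' p : {p // p ∉ S}, 1 / (((p : Nat.Primes) : ℕ) : ℝ) ^ 2 := by
    calc (∑ p ∈ hfin.toFinset, ((B p).card : ℝ))
        ≤ ∑ p ∈ hfin.toFinset, (N : ℝ) * (1 / (((p : Nat.Primes) : ℕ) : ℝ) ^ 2) := by
          refine Finset.sum_le_sum fun p _ => ?_
          rw [Nat.card_multiples, mul_one_div]
          exact_mod_cast Nat.cast_div_le (α := ℝ) (m := N) (n := ((p : Nat.Primes) : ℕ) ^ 2)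
      _ = N * ∑ p ∈ hfin.toFinset, 1 / (((p : Nat.Primes) : ℕ) : ℝ) ^ 2 := by
          rw [Finset.mul_sum]
      _ ≤ _ := by
          gcongr
          exact (summable_one_div_prime_sq.comp_injective
            Subtype.val_injective).sum_le_tsum _ fun _ _ => by positivity
  have hcard' : (A.card : ℝ) ≤ (sqfreeBelow N).card + ∑ p ∈ hfin.toFinset, ((B p).card : ℝ) := by
    exact_mod_cast hcard
  have hAr : (A.card : ℝ) = N * ∏ p ∈ S, (1 - 1 / ((p : ℕ) : ℝ) ^ 2) := by
    rw [hA, Nat.cast_mul, cast_prod_sq_sub_one, Nat.cast_mul, mul_assoc]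
  rw [mul_sub]
  linarith

lemma le_coverEntropy_sqfFlow (S : Finset Nat.Primes) :
    ((Real.log 2 * (∏ p ∈ S, (1 - 1 / ((p : ℕ) : ℝ) ^ 2) -
      ∑' p : {p // p ∉ S}, 1 / (((p : Nat.Primes) : ℕ) : ℝ) ^ 2) : ℝ) : EReal) ≤
      coverEntropy shift SqfFlow := by
  refine le_coverEntropy_shift ?_
  have hM := prod_sq_pos S
  refine ((tendsto_id.atTop_mul_const' hM).frequently (p := fun n => ∃ s : Finset Omega2, _) <|
    Frequently.of_forall fun k => ?_)
  set N := id k * ∏ p : S, ((p : Nat.Primes) : ℕ) ^ 2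
  have hinj : Function.Injective fun (t : Finset ℕ) (n : ℕ) => decide (n ∈ t) := by
    intro t u h
    ext n
    simpa using congrFun h n
  refine ⟨(sqfreeBelow N).powerset.image fun t n => decide (n ∈ t), ?_, ?_, ?_⟩
  · intro x hx p
    obtain ⟨t, ht, rfl⟩ := Finset.mem_image.1 (Finset.mem_coe.1 hx)
    refine ⟨0, fun n hn => decide_eq_false fun hnt => ?_⟩
    exact (Finset.mem_filter.1 (Finset.mem_powerset.1 ht hnt)).2 p
      ((ZMod.natCast_eq_zero_iff _ _).1 hn)
  · intro x hx y hy hxy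
    obtain ⟨t, ht, rfl⟩ := Finset.mem_image.1 hx
    obtain ⟨u, hu, rfl⟩ := Finset.mem_image.1 hy
    funext n
    by_cases hn : n < N
    · exact hxy n hn
    · have hnot : n ∉ sqfreeBelow N := fun h =>
        hn (Finset.mem_range.1 (Finset.mem_filter.1 h).1)
      have h1 : n ∉ t := fun h => hnot (Finset.mem_powerset.1 ht h)
      have h2 : n ∉ u := fun h => hnot (Finset.mem_powerset.1 hu h)
      simp [h1, h2]
  · rw [Finset.card_image_of_injective _ hinj, Finset.card_powerset, Nat.cast_pow, Nat.cast_two,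
      two_pow_eq_exp, mul_assoc]
    gcongr
    rw [mul_comm]
    exact le_card_sqfreeBelow S k

lemma coverEntropy_sqfFlow :
    coverEntropy shift SqfFlow = ((6 / Real.pi ^ 2 * Real.log 2 : ℝ) : EReal) := by
  have hprod : Tendsto (fun S : Finset Nat.Primes => ∏ p ∈ S, (1 - 1 / ((p : ℕ) : ℝ) ^ 2)) atTop
      (𝓝 (6 / Real.pi ^ 2)) := hasProd_one_sub_inv_sq
  have htail := tendsto_tsum_compl_atTop_zero
    fun p : Nat.Primes => 1 / ((p : ℕ) : ℝ) ^ 2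
  rw [mul_comm]
  apply le_antisymm
  · exact ge_of_tendsto' ((continuous_coe_real_ereal.tendsto _).comp
      (hprod.const_mul (Real.log 2))) coverEntropy_sqfFlow_le
  · have h := (hprod.sub htail).const_mul (Real.log 2)
    rw [sub_zero] at h
    exact le_of_tendsto' ((continuous_coe_real_ereal.tendsto _).comp h) le_coverEntropy_sqfFlow

end Primes

open Dynamics in
/-- The topological entropy of the squarefree flow `(X, σ)` equals
`log 2 · ∏_p (1 − 1/p²) = (6/π²) log 2`, the product running over all primes. -/
theorem squarefree_flow_topEntropy :
    coverEntropy shift SqfFlow =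
      ((Real.log 2 * ∏' p : Nat.Primes, (1 - 1 / ((p : ℕ) : ℝ) ^ 2) : ℝ) : EReal) ∧
    coverEntropy shift SqfFlow = ((6 / Real.pi ^ 2 * Real.log 2 : ℝ) : EReal) := by
  refine ⟨?_, coverEntropy_sqfFlow⟩
  rw [coverEntropy_sqfFlow, hasProd_one_sub_inv_sq.tprod_eq, mul_comm]

end
end

section
/- For each r ≥ 1 the partial insertion map ι_r : G × Ω⁽²⁾ → X(r) is continuous and surjective, and ι_r → ι pointwise everywhere on G × Ω⁽²⁾ as r → ∞; consequently ι is Borel measurable. -/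
open MeasureTheory Filter Set
open scoped ENNReal Classical

noncomputable section

theorem rho_spec {x : Omega2} {p : Nat.Primes}
    (h : ∃ a : ZMod ((p : ℕ) ^ 2), OmitsMod x ((p : ℕ) ^ 2) a) :
    OmitsMod x ((p : ℕ) ^ 2) (rho x p) := by
  rw [rho, dif_pos h]
  exact h.choose_spec

theorem nthPrime_surjective : Function.Surjective nthPrime := fun p =>
  ⟨Nat.count Nat.Prime p, Subtype.ext (Nat.nth_count p.2)⟩

theorem continuous_iotaR (r : ℕ) : Continuous (fun gy : G × Omega2 => iotaR r gy.1 gy.2) := by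
  refine continuous_pi fun n => ?_
  let F : (∀ k : Fin r, ZMod ((nthPrime k : ℕ) ^ 2)) × Omega2 → Bool := fun hy =>
    if ∃ k : Fin r, ((n + 1 : ℕ) : ZMod ((nthPrime k : ℕ) ^ 2)) = hy.1 k then false
    else hy.2 (n - Set.ncard {i : ℕ | 1 ≤ i ∧ i ≤ n + 1 ∧
      ∃ k : Fin r, ((i : ℕ) : ZMod ((nthPrime k : ℕ) ^ 2)) = hy.1 k})
  have hF : Continuous F := by
    refine continuous_prod_of_discrete_left.2 fun h => ?_
    by_cases hc : ∃ k : Fin r, ((n + 1 : ℕ) : ZMod ((nthPrime k : ℕ) ^ 2)) = h k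
    · simp only [F, if_pos hc]
      exact continuous_const
    · simp only [F, if_neg hc]
      exact continuous_apply _
  have hres : Continuous fun gy : G × Omega2 =>
      ((fun k : Fin r => gy.1 (nthPrime k), gy.2) :
        (∀ k : Fin r, ZMod ((nthPrime k : ℕ) ^ 2)) × Omega2) :=
    (continuous_pi fun k : Fin r => (continuous_apply (nthPrime k)).comp continuous_fst).prodMk
      continuous_snd
  exact hF.comp hres

theorem iotaR_mem_Xr (r : ℕ) (g : G) (y : Omega2) : iotaR r g y ∈ Xr r := fun k =>
  ⟨g (nthPrime k), fun _ hn => if_pos ⟨k, hn⟩⟩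

theorem ncard_shifted_eq_count (P : ℕ → Prop) (m : ℕ) :
    Set.ncard {n : ℕ | 1 ≤ n ∧ n ≤ m ∧ P n} = Nat.count (fun j => P (j + 1)) m := by
  have h : {n : ℕ | 1 ≤ n ∧ n ≤ m ∧ P n} =
      (fun j => j + 1) '' ((Finset.range m).filter fun j => P (j + 1) : Finset ℕ) := by
    ext n
    simp only [Set.mem_ofPred_eq, Set.mem_image, Finset.coe_filter, Finset.mem_range]
    constructor
    · rintro ⟨h1, h2, h3⟩
      obtain ⟨j, rfl⟩ := Nat.exists_eq_add_of_le' h1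
      exact ⟨j, ⟨h2, h3⟩, rfl⟩
    · rintro ⟨j, ⟨h2, h3⟩, rfl⟩
      exact ⟨by omega, h2, h3⟩
  rw [h, Set.ncard_image_of_injective _ (add_left_injective 1), Set.ncard_coe_finset,
    Nat.count_eq_card_filter_range]

theorem count_add_count_not (P : ℕ → Prop) (n : ℕ) :
    Nat.count P n + Nat.count (fun j => ¬ P j) n = n := by
  simp only [Nat.count_eq_card_filter_range]
  simpa using Finset.card_filter_add_card_filter_not (s := Finset.range n) P

theorem nth_not_sub_ncard {P : ℕ → Prop} {n : ℕ} (hn : ¬ P (n + 1)) :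
    Nat.nth (fun j => ¬ P (j + 1)) (n - Set.ncard {i : ℕ | 1 ≤ i ∧ i ≤ n + 1 ∧ P i}) = n := by
  have h := count_add_count_not (fun j => P (j + 1)) n
  rw [ncard_shifted_eq_count, Nat.count_succ, if_neg hn, add_zero,
    show n - Nat.count (fun j => P (j + 1)) n = Nat.count (fun j => ¬ P (j + 1)) n by omega,
    Nat.nth_count (p := fun j => ¬ P (j + 1)) hn]

theorem range_iotaR (r : ℕ) :
    Set.range (fun gy : G × Omega2 => iotaR r gy.1 gy.2) = Xr r := by
  refine Set.Subset.antisymm (Set.range_subset_iff.2 fun gy => iotaR_mem_Xr r gy.1 gy.2)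
    fun x hx => ?_
  let P : ℕ → Prop := fun n =>
    ∃ k : Fin r, (n : ZMod ((nthPrime k : ℕ) ^ 2)) = rho x (nthPrime k)
  refine ⟨(rho x, fun m => x (Nat.nth (fun j => ¬ P (j + 1)) m)), funext fun n => ?_⟩
  by_cases hn : P (n + 1)
  · obtain ⟨k, hk⟩ := hn
    exact (if_pos ⟨k, hk⟩).trans (rho_spec (hx k) n hk).symm
  · exact (if_neg hn).trans (congrArg x (nth_not_sub_ncard hn))

theorem eventually_exists_fin_iff (g : G) (m : ℕ) :
    ∀ᶠ r : ℕ in atTop, (∃ k : Fin r, (m : ZMod ((nthPrime k : ℕ) ^ 2)) = g (nthPrime k)) ↔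
      ∃ p : Nat.Primes, (m : ZMod ((p : ℕ) ^ 2)) = g p := by
  by_cases h : ∃ p : Nat.Primes, (m : ZMod ((p : ℕ) ^ 2)) = g p
  · obtain ⟨p, hp⟩ := h
    obtain ⟨k, rfl⟩ := nthPrime_surjective p
    filter_upwards [eventually_gt_atTop k] with r hr
    exact ⟨fun _ => ⟨_, hp⟩, fun _ => ⟨⟨k, hr⟩, hp⟩⟩
  · exact Eventually.of_forall fun r => ⟨fun ⟨k, hk⟩ => ⟨_, hk⟩, fun h' => (h h').elim⟩

theorem tendsto_iotaR (g : G) (y : Omega2) :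
    Tendsto (fun r : ℕ => iotaR r g y) atTop (nhds (iota g y)) := by
  refine tendsto_pi_nhds.2 fun n => tendsto_const_nhds.congr' ?_
  have h := (Set.finite_Iic (n + 1)).eventually_all.2 fun m _ => eventually_exists_fin_iff g m
  filter_upwards [h] with r hr
  have hα : alphaGr r g (n + 1) = alphaG g (n + 1) := by
    refine congrArg Set.ncard (Set.ext fun m => ?_)
    exact and_congr_right fun _ => and_congr_right fun hm => hr m hm
  simp only [iota, iotaR, hα]
  exact (if_congr (hr (n + 1) Set.self_mem_Iic) rfl rfl).symm

theorem measurable_iota : Measurable (fun gy : G × Omega2 => iota gy.1 gy.2) :=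
  measurable_of_tendsto_metrizable (fun r => (continuous_iotaR r).measurable)
    (tendsto_pi_nhds.2 fun gy => tendsto_iotaR gy.1 gy.2)

/-- For each `r ≥ 1` the partial insertion map `ι_r : G × Ω⁽²⁾ → X(r)`
is continuous and surjective, `ι_r → ι` pointwise everywhere on `G × Ω⁽²⁾` (in the
product topology of `Ω⁽²⁾`), and consequently `ι` is Borel measurable. -/
theorem partial_insertion_properties :
    (∀ r : ℕ, 1 ≤ r →
      Continuous (fun gy : G × Omega2 => iotaR r gy.1 gy.2) ∧
      Set.range (fun gy : G × Omega2 => iotaR r gy.1 gy.2) = Xr r) ∧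
    (∀ gy : G × Omega2,
      Filter.Tendsto (fun r : ℕ => iotaR r gy.1 gy.2) Filter.atTop (nhds (iota gy.1 gy.2))) ∧
    Measurable (fun gy : G × Omega2 => iota gy.1 gy.2) :=
  ⟨fun r _ => ⟨continuous_iotaR r, range_iotaR r⟩, fun gy => tendsto_iotaR gy.1 gy.2,
    measurable_iota⟩

end
end
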